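/- arXiv:2405.20286 — 3 statements merged into one kernel-verified Lean document; each statement's English description precedes it below -/
import Mathlib

section
/- A graph G has a fractional perfect matching if and only if for every vertex subset S of G, the number of isolated vertices of G \ S is at most |S|. -/
open scoped Classical

noncomputable section

variable {V : Type*}

/-- A fractional perfect matching of `G`: a `[0,1]`-weighting of the edges such that every
vertex receives total weight `1`. -/
def SimpleGraph.HasFracPerfectMatching [Fintype V] (G : SimpleGraph V) : Prop :=
  ∃ f : Sym2 V → ℝ,
    (∀ e, 0 ≤ f e ∧ f e ≤ 1) ∧
    ∀ v : V,
      (∑ e ∈ Finset.univ.filter (fun e : Sym2 V => e ∈ G.edgeSet ∧ v ∈ e), f e) = 1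

lemma fpm_forward [Fintype V] (G : SimpleGraph V) (h : G.HasFracPerfectMatching)
    (S I : Finset V) (hI : ∀ a b, G.Adj a b → a ∈ I → b ∈ S) (hd : ∀ a ∈ I, a ∉ S) :
    I.card ≤ S.card := by
  obtain ⟨f, hf, hs⟩ := h
  have key : ∀ T : Finset V, (T.card : ℝ) =
      ∑ e ∈ Finset.univ.filter (fun e : Sym2 V => e ∈ G.edgeSet),
        f e * ((T.filter (fun v => v ∈ e)).card : ℝ) := by
    intro T
    calc (T.card : ℝ) = ∑ v ∈ T, (1 : ℝ) := by simp
      _ = ∑ v ∈ T, ∑ e ∈ Finset.univ.filter (fun e : Sym2 V => e ∈ G.edgeSet),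
            if v ∈ e then f e else 0 := by
          refine Finset.sum_congr rfl fun v _ => ?_
          rw [← hs v, ← Finset.sum_filter, Finset.filter_filter]
      _ = _ := by
          rw [Finset.sum_comm]
          refine Finset.sum_congr rfl fun e _ => ?_
          rw [← Finset.sum_filter, Finset.sum_const, nsmul_eq_mul, mul_comm]
  have : (I.card : ℝ) ≤ S.card := by
    rw [key I, key S]
    refine Finset.sum_le_sum fun e he => mul_le_mul_of_nonneg_left ?_ (hf e).1
    rw [Finset.mem_filter] at he
    have he := he.2
    norm_cast
    induction e using Sym2.ind with
    | _ a b =>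
      rw [SimpleGraph.mem_edgeSet] at he
      have hab := he.ne
      refine Finset.card_le_card_of_injOn (fun x => if x = a then b else a) ?_ ?_
      · intro x hx
        simp only [Finset.coe_filter, Set.mem_setOf_eq, Sym2.mem_iff] at hx ⊢
        obtain ⟨hx, rfl | rfl⟩ := hx
        · simpa using hI _ _ he hx
        · simpa [hab.symm] using hI _ _ he.symm hx
      · intro x hx y hy hxy
        simp only [Finset.coe_filter, Set.mem_setOf_eq, Sym2.mem_iff] at hx hy hxy
        grind
  exact_mod_cast this

lemma fpm_backward [Fintype V] (G : SimpleGraph V)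
    (h : ∀ S I : Finset V, (∀ a ∈ I, a ∉ S) → (∀ a b, G.Adj a b → a ∈ I → b ∈ S) →
      I.card ≤ S.card) : G.HasFracPerfectMatching := by
  have hall := (Fintype.all_card_le_filter_rel_iff_exists_injective
    (fun a b : V => G.Adj a b)).1 (by
      intro A
      set N : Finset V → Finset V := fun A => Finset.univ.filter (fun b => ∃ a ∈ A, G.Adj a b)
        with hN
      have mN : ∀ A b, b ∈ N A ↔ ∃ a ∈ A, G.Adj a b := by intro A b; simp [hN]
      have h1 := h (N (A \ N A)) (A \ N A) (by
        intro a ha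
        simp only [mN, Finset.mem_sdiff] at ha ⊢
        grind) (by
        intro a b hab ha
        exact (mN _ _).2 ⟨a, ha, hab⟩)
      have h2 : N (A \ N A) ∪ (A ∩ N A) ⊆ N A := by
        intro x hx
        simp only [mN, Finset.mem_sdiff, Finset.mem_union, Finset.mem_inter] at hx ⊢
        grind
      have h3 : Disjoint (N (A \ N A)) (A ∩ N A) := by
        rw [Finset.disjoint_left]
        intro x hx hx'
        simp only [mN, Finset.mem_sdiff, Finset.mem_inter] at hx hx'
        obtain ⟨a, ⟨ha, hna⟩, hax⟩ := hx
        exact hna ⟨x, hx'.1, hax.symm⟩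
      have h4 := Finset.card_le_card h2
      rw [Finset.card_union_of_disjoint h3] at h4
      have h5 := Finset.card_sdiff_add_card_inter A (N A)
      have h6 : A.card ≤ (N A).card := by omega
      convert h6)
  obtain ⟨g, hg, hadj⟩ := hall
  have hsurj := Finite.surjective_of_injective hg
  refine ⟨fun e => (1 / 2) * ((Finset.univ.filter (fun u : V => s(u, g u) = e)).card : ℝ),
    ?_, ?_⟩
  · intro e
    refine ⟨by positivity, ?_⟩
    have : (Finset.univ.filter (fun u : V => s(u, g u) = e)).card ≤ 2 := by
      induction e using Sym2.ind with
      | _ a b =>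
        refine (Finset.card_le_card (t := {a, b}) ?_).trans Finset.card_le_two
        intro u hu
        simp only [Finset.mem_filter, Finset.mem_univ, true_and, Sym2.eq_iff] at hu
        simp only [Finset.mem_insert, Finset.mem_singleton]
        tauto
    have : ((Finset.univ.filter (fun u : V => s(u, g u) = e)).card : ℝ) ≤ 2 := by
      exact_mod_cast this
    linarith
  · intro v
    rw [← Finset.mul_sum, ← Nat.cast_sum]
    have : ∑ e ∈ Finset.univ.filter (fun e : Sym2 V => e ∈ G.edgeSet ∧ v ∈ e),
        (Finset.univ.filter (fun u : V => s(u, g u) = e)).card = 2 := by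
      obtain ⟨w, rfl⟩ := hsurj v
      have hne : g w ≠ w := (hadj w).ne'
      rw [← Finset.card_pair hne]
      rw [Finset.card_eq_sum_card_fiberwise (f := fun u : V => s(u, g u))
        (t := Finset.univ.filter (fun e : Sym2 V => e ∈ G.edgeSet ∧ g w ∈ e))]
      · refine Finset.sum_congr rfl fun e he => ?_
        congr 1
        ext u
        simp only [Finset.mem_filter, Finset.mem_univ, true_and, Finset.mem_insert,
          Finset.mem_singleton] at he ⊢
        refine ⟨fun hu => ⟨?_, hu⟩, fun hu => hu.2⟩
        have := he.2
        rw [← hu, Sym2.mem_iff] at this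
        rcases this with h | h
        · exact Or.inl h.symm
        · exact Or.inr (hg h.symm)
      · intro u hu
        simp only [Finset.coe_insert, Finset.coe_singleton, Set.mem_insert_iff,
          Set.mem_singleton_iff] at hu
        simp only [Finset.coe_filter, Finset.mem_univ, true_and, Set.mem_setOf_eq,
          SimpleGraph.mem_edgeSet, Sym2.mem_iff]
        refine ⟨hadj u, ?_⟩
        rcases hu with rfl | rfl <;> simp
    rw [this]; norm_num

lemma fpm_card [Fintype V] (G : SimpleGraph V) (S : Finset V) :
    Nat.card {v : ((↑S : Set V)ᶜ : Set V) //
            ∀ w : ((↑S : Set V)ᶜ : Set V), ¬ (G.induce ((↑S : Set V)ᶜ)).Adj v w} =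
    (Finset.univ.filter (fun v : V => v ∉ S ∧ ∀ w, G.Adj v w → w ∈ S)).card := by
  rw [← Fintype.card_subtype, ← Nat.card_eq_fintype_card]
  refine Nat.card_congr
    { toFun := fun v => ⟨v.1.1, fun h => v.1.2 (by simpa using h), fun w hw => by
        by_contra hwS
        exact v.2 ⟨w, by simpa using hwS⟩ (by simpa using hw)⟩
      invFun := fun v => ⟨⟨v.1, by simpa using v.2.1⟩, fun w hw => by
        have := v.2.2 w.1 (by simpa using hw)
        exact w.2 (by simpa using this)⟩
      left_inv := fun v => rfl
      right_inv := fun v => rfl }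

/-- A graph `G` has a fractional perfect matching iff for every vertex subset `S`,
the number of isolated vertices of `G \ S` is at most `|S|`. -/
theorem fracPerfectMatching_iff_isolated_le [Fintype V] (G : SimpleGraph V) :
    G.HasFracPerfectMatching ↔
      ∀ S : Finset V,
        Nat.card {v : ((↑S : Set V)ᶜ : Set V) //
            ∀ w : ((↑S : Set V)ᶜ : Set V), ¬ (G.induce ((↑S : Set V)ᶜ)).Adj v w} ≤ S.card := by
  constructor
  · intro h S
    rw [fpm_card]
    refine fpm_forward G h S _ ?_ ?_
    · intro a b hab ha
      exact (Finset.mem_filter.1 ha).2.2 b hab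
    · intro a ha
      exact (Finset.mem_filter.1 ha).2.1
  · intro h
    refine fpm_backward G fun S I h1 h2 => ?_
    have := h S
    rw [fpm_card] at this
    refine (Finset.card_le_card ?_).trans this
    intro a ha
    simp only [Finset.mem_filter, Finset.mem_univ, true_and]
    exact ⟨h1 a ha, fun w hw => h2 a w hw ha⟩
end
end

section
/- Let T_k denote the family of trees on 2k-1 edges obtained by joining k disjoint copies of P2 (single edges) using k-1 additional edges. A connected graph H has a fractional P3-decomposition if and only if H does not belong to T_k for any k ≥ 1. -/
open scoped Classical

noncomputable section

variable {V : Type*}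

/-- `K` is a `P₃`-subgraph of `G`: an unordered pair of distinct incident edges of `G`. -/
def SimpleGraph.IsP3Sub (G : SimpleGraph V) (K : Sym2 (Sym2 V)) : Prop :=
  ∃ e₁ e₂ : Sym2 V, K = s(e₁, e₂) ∧ e₁ ∈ G.edgeSet ∧ e₂ ∈ G.edgeSet ∧ e₁ ≠ e₂ ∧
    ∃ v : V, v ∈ e₁ ∧ v ∈ e₂

/-- A fractional `P₃`-decomposition of `G`. -/
def SimpleGraph.HasFracP3Decomp [Fintype V] (G : SimpleGraph V) : Prop :=
  ∃ f : Sym2 (Sym2 V) → ℝ,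
    (∀ K, 0 ≤ f K ∧ f K ≤ 1) ∧
    ∀ e ∈ G.edgeSet,
      (∑ K ∈ Finset.univ.filter (fun K : Sym2 (Sym2 V) => G.IsP3Sub K ∧ e ∈ K), f K) = 1

/-- A connected component is an isolated `P₂`: a single edge together with its two endpoints. -/
def SimpleGraph.IsP2Component (G : SimpleGraph V) (c : G.ConnectedComponent) : Prop :=
  ∃ u v : V, G.Adj u v ∧ c.supp = {u, v}
/-- `G` belongs to the family `T_k`: `G` is a tree with a set `F` of `k-1` edges whose removal
leaves exactly `k` disjoint copies of `P₂` (isolated single edges) as connected components. -/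
def SimpleGraph.InTk [Fintype V] (G : SimpleGraph V) (k : ℕ) : Prop :=
  G.IsTree ∧ ∃ F : Finset (Sym2 V), ↑F ⊆ G.edgeSet ∧ F.card = k - 1 ∧
    (∀ c : (G.deleteEdges ↑F).ConnectedComponent, (G.deleteEdges ↑F).IsP2Component c) ∧
    Nat.card {c : (G.deleteEdges ↑F).ConnectedComponent //
      (G.deleteEdges ↑F).IsP2Component c} = k

/-- The edges of `H` incident to, and different from, `e`. -/
def p3Nb [Fintype V] (H : SimpleGraph V) (e : Sym2 V) : Finset (Sym2 V) :=
  Finset.univ.filter (fun e' => e' ∈ H.edgeSet ∧ e ≠ e' ∧ ∃ v, v ∈ e ∧ v ∈ e')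

lemma mem_p3Nb [Fintype V] (H : SimpleGraph V) (e e' : Sym2 V) :
    e' ∈ p3Nb H e ↔ e' ∈ H.edgeSet ∧ e ≠ e' ∧ ∃ v, v ∈ e ∧ v ∈ e' := by
  simp [p3Nb]

/-- A set of pairwise non-incident edges. -/
def p3Mat (M : Finset (Sym2 V)) : Prop :=
  ∀ e ∈ M, ∀ e' ∈ M, ∀ v, v ∈ e → v ∈ e' → e = e'

lemma p3_hall [Fintype V] (H : SimpleGraph V)
    (h : ∀ M : Finset (Sym2 V), (∀ e ∈ M, e ∈ H.edgeSet) → p3Mat M →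
      M.card ≤ (M.biUnion (p3Nb H)).card)
    (S : Finset (Sym2 V)) (hS : ∀ e ∈ S, e ∈ H.edgeSet) :
    S.card ≤ (S.biUnion (p3Nb H)).card := by
  set M := S.filter (fun e => ∀ e' ∈ S, e' ∉ p3Nb H e) with hM
  have hMm : p3Mat M := by
    intro e he e' he' v hv hv'
    by_contra hne
    rw [hM, Finset.mem_filter] at he he'
    exact he.2 e' he'.1 ((mem_p3Nb _ _ _).2 ⟨hS _ he'.1, hne, v, hv, hv'⟩)
  have h1 := h M (fun e he => hS e (Finset.mem_filter.1 he).1) hMm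
  have hdisj : Disjoint (S \ M) (M.biUnion (p3Nb H)) := by
    rw [Finset.disjoint_left]
    intro e he he'
    obtain ⟨m, hm, hme⟩ := Finset.mem_biUnion.1 he'
    rw [hM, Finset.mem_filter] at hm
    exact hm.2 e (Finset.mem_sdiff.1 he).1 hme
  have hsub : (S \ M) ∪ (M.biUnion (p3Nb H)) ⊆ S.biUnion (p3Nb H) := by
    intro e he
    rcases Finset.mem_union.1 he with he | he
    · obtain ⟨he1, he2⟩ := Finset.mem_sdiff.1 he
      rw [hM, Finset.mem_filter] at he2
      push Not at he2
      obtain ⟨e', he', hn⟩ := he2 he1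
      obtain ⟨_, b, v, c, d⟩ := (mem_p3Nb _ _ _).1 hn
      exact Finset.mem_biUnion.2 ⟨e', he', (mem_p3Nb _ _ _).2 ⟨hS _ he1, b.symm, v, d, c⟩⟩
    · exact Finset.biUnion_subset_biUnion_of_subset_left _ (Finset.filter_subset _ _) he
  have h2 := Finset.card_le_card hsub
  rw [Finset.card_union_of_disjoint hdisj] at h2
  have h3 : (S \ M).card + M.card = S.card :=
    Finset.card_sdiff_add_card_eq_card (Finset.filter_subset _ _)
  omega

lemma p3_parent [Fintype V] (H : SimpleGraph V) (hH : H.Connected)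
    (M : Finset (Sym2 V)) (hME : ∀ e ∈ M, e ∈ H.edgeSet) (hM : p3Mat M) (r : V) :
    (M.filter (fun e => r ∉ e)).card ≤ (M.biUnion (p3Nb H)).card := by
  have key : ∀ e ∈ M.filter (fun e => r ∉ e), ∃ u w : V, u ∈ e ∧ w ∉ e ∧ H.Adj u w ∧
      H.dist w r < H.dist u r := by
    intro e he
    obtain ⟨heM, hr⟩ := Finset.mem_filter.1 he
    have main : ∀ a b : V, H.dist a r ≤ H.dist b r → a ≠ r →
        ∃ u w : V, u ∈ s(a, b) ∧ w ∉ s(a, b) ∧ H.Adj u w ∧ H.dist w r < H.dist u r := by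
      intro a b hab har
      obtain ⟨p, hp⟩ := hH.exists_walk_length_eq_dist a r
      cases p with
      | nil => exact absurd rfl har
      | @cons _ w _ hadj q =>
        have h1 : H.dist w r ≤ q.length := SimpleGraph.dist_le q
        rw [SimpleGraph.Walk.length_cons] at hp
        refine ⟨a, w, by simp, ?_, hadj, by omega⟩
        rw [Sym2.mem_iff]
        rintro (rfl | rfl) <;> omega
    induction e using Sym2.ind with
    | _ a b =>
      rw [Sym2.mem_iff] at hr
      push Not at hr
      rcases le_total (H.dist a r) (H.dist b r) with h | h
      · exact main a b h hr.1.symm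
      · rw [Sym2.eq_swap]
        exact main b a h hr.2.symm
  have : Nonempty V := ⟨r⟩
  choose! u w hu hw hadj hd using key
  apply Finset.card_le_card_of_injOn (fun e => s(u e, w e))
  · intro e he
    have heM := (Finset.mem_filter.1 he).1
    refine Finset.mem_coe.2 (Finset.mem_biUnion.2 ⟨e, heM, (mem_p3Nb _ _ _).2
      ⟨hadj e he, ?_, u e, hu e he, by simp⟩⟩)
    intro h
    have h2 : w e ∈ s(u e, w e) := by simp
    have h3 : ∀ x, x ∈ s(u e, w e) → x ∈ e := fun x hx => by
      have h4 : e = s(u e, w e) := h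
      rw [h4]
      exact hx
    exact hw e he (h3 _ h2)
  · intro e he e' he' h
    have heM := (Finset.mem_filter.1 he).1
    have heM' := (Finset.mem_filter.1 he').1
    have d1 := hd e he
    have d2 := hd e' he'
    rcases Sym2.eq_iff.1 h with ⟨h1, _⟩ | ⟨h1, h2⟩
    · exact hM e heM e' heM' (u e) (hu e he) (h1 ▸ hu e' he')
    · rw [h1, h2] at d1
      omega

lemma p3_card_comp [Fintype V] (G : SimpleGraph V)
    (h : ∀ c : G.ConnectedComponent, G.IsP2Component c) :
    Nat.card {c : G.ConnectedComponent // G.IsP2Component c} = Nat.card G.edgeSet := by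
  choose u v hadj hs using h
  apply Nat.card_congr
  refine Equiv.ofBijective (fun c => (⟨s(u c.1, v c.1), hadj c.1⟩ : G.edgeSet)) ⟨?_, ?_⟩
  · intro c d hcd
    have h1 : s(u c.1, v c.1) = s(u d.1, v d.1) := congrArg Subtype.val hcd
    have h2 : u c.1 ∈ c.1.supp := by rw [hs]; simp
    have h3 : u c.1 ∈ d.1.supp := by
      rw [hs]
      have : u c.1 ∈ s(u d.1, v d.1) := by rw [← h1]; simp
      simpa using this
    rw [SimpleGraph.ConnectedComponent.mem_supp_iff] at h2 h3
    exact Subtype.ext (h2.symm.trans h3)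
  · rintro ⟨e, he⟩
    induction e using Sym2.ind with
    | _ a b =>
      have hab : G.Adj a b := he
      refine ⟨⟨G.connectedComponentMk a, _, _, hadj _, hs _⟩, Subtype.ext ?_⟩
      have h1 : a ∈ (G.connectedComponentMk a).supp := rfl
      have h2 : b ∈ (G.connectedComponentMk a).supp := by
        rw [SimpleGraph.ConnectedComponent.mem_supp_iff]
        exact SimpleGraph.ConnectedComponent.sound hab.symm.reachable
      rw [hs] at h1 h2
      have := hab.ne
      simp only [Set.mem_insert_iff, Set.mem_singleton_iff] at h1 h2
      simp only [Sym2.eq_iff]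
      grind

lemma p3_forward [Fintype V] (H : SimpleGraph V) (hf : H.HasFracP3Decomp) (k : ℕ) (hk : 1 ≤ k)
    (hT : H.InTk k) : False := by
  obtain ⟨f, hf01, hf1⟩ := hf
  obtain ⟨_, F, hFE, hFc, hP, hc⟩ := hT
  rw [p3_card_comp _ hP] at hc
  set M : Finset (Sym2 V) := (H.deleteEdges ↑F).edgeFinset with hMdef
  have hMc : M.card = k := by
    rw [← hc, Nat.card_eq_fintype_card, hMdef, SimpleGraph.edgeFinset_card]
  have hmemM : ∀ e, e ∈ M ↔ e ∈ H.edgeSet ∧ e ∉ F := by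
    intro e
    rw [hMdef, SimpleGraph.mem_edgeFinset, SimpleGraph.edgeSet_deleteEdges]
    simp
  have hM : p3Mat M := by
    intro e he e' he' x hx hx'
    obtain ⟨u, v, -, hs⟩ := hP ((H.deleteEdges ↑F).connectedComponentMk x)
    have main : ∀ e ∈ M, x ∈ e → e = s(u, v) := by
      intro e he hx
      obtain ⟨y, rfl⟩ := Sym2.mem_iff_exists.1 hx
      have hab : (H.deleteEdges ↑F).Adj x y := SimpleGraph.mem_edgeFinset.1 he
      have h1 : x ∈ ((H.deleteEdges ↑F).connectedComponentMk x).supp := rfl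
      have h2 : y ∈ ((H.deleteEdges ↑F).connectedComponentMk x).supp := by
        rw [SimpleGraph.ConnectedComponent.mem_supp_iff]
        exact SimpleGraph.ConnectedComponent.sound hab.symm.reachable
      rw [hs] at h1 h2
      have := hab.ne
      simp only [Set.mem_insert_iff, Set.mem_singleton_iff] at h1 h2
      simp only [Sym2.eq_iff]
      grind
    rw [main e he hx, main e' he' hx']
  have hle : ∑ e ∈ M, ∑ K ∈ Finset.univ.filter
      (fun K : Sym2 (Sym2 V) => H.IsP3Sub K ∧ e ∈ K), f K ≤
      ∑ e ∈ F, ∑ K ∈ Finset.univ.filter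
      (fun K : Sym2 (Sym2 V) => H.IsP3Sub K ∧ e ∈ K), f K := by
    simp only [Finset.sum_filter]
    rw [Finset.sum_comm, Finset.sum_comm (s := F)]
    apply Finset.sum_le_sum
    intro K _
    rw [← Finset.sum_filter, ← Finset.sum_filter, Finset.sum_const, Finset.sum_const]
    refine nsmul_le_nsmul_left (hf01 K).1 ?_
    by_cases hK : H.IsP3Sub K
    · obtain ⟨e₁, e₂, rfl, h1, h2, hne, v, hv1, hv2⟩ := hK
      by_cases hempty : (M.filter (fun e => H.IsP3Sub s(e₁, e₂) ∧ e ∈ s(e₁, e₂))) = ∅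
      · rw [hempty]; simp
      · have hn : ¬ (e₁ ∈ M ∧ e₂ ∈ M) := fun h => hne (hM _ h.1 _ h.2 v hv1 hv2)
        have hP3 : H.IsP3Sub s(e₁, e₂) := ⟨e₁, e₂, rfl, h1, h2, hne, v, hv1, hv2⟩
        have hle1 : (M.filter (fun e => H.IsP3Sub s(e₁, e₂) ∧ e ∈ s(e₁, e₂))).card ≤ 1 := by
          rw [Finset.card_le_one]
          intro a ha b hb
          simp only [Finset.mem_filter, Sym2.mem_iff] at ha hb
          grind
        refine hle1.trans (Finset.card_pos.2 ?_)
        by_cases h1M : e₁ ∈ M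
        · have h2M : e₂ ∈ F := by
            by_contra h
            exact hn ⟨h1M, (hmemM _).2 ⟨h2, h⟩⟩
          exact ⟨e₂, Finset.mem_filter.2 ⟨h2M, hP3, by simp⟩⟩
        · have h1F : e₁ ∈ F := by
            by_contra h
            exact h1M ((hmemM _).2 ⟨h1, h⟩)
          exact ⟨e₁, Finset.mem_filter.2 ⟨h1F, hP3, by simp⟩⟩
    · simp [hK]
  rw [Finset.sum_congr rfl (fun e he => hf1 e ((hmemM e).1 he).1),
    Finset.sum_congr rfl (fun e he => hf1 e (hFE he))] at hle
  simp only [Finset.sum_const, nsmul_eq_mul, mul_one, Nat.cast_le] at hle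
  omega

lemma p3_matching [Fintype V] (H : SimpleGraph V) (hH : H.Connected)
    (hT : ∀ k : ℕ, 1 ≤ k → ¬ H.InTk k)
    (M : Finset (Sym2 V)) (hME : ∀ e ∈ M, e ∈ H.edgeSet) (hM : p3Mat M) :
    M.card ≤ (M.biUnion (p3Nb H)).card := by
  by_contra hlt
  push Not at hlt
  have hcov : ∀ r : V, ∃ e ∈ M, r ∈ e := by
    intro r
    by_contra hr
    push Not at hr
    have := p3_parent H hH M hME hM r
    rw [Finset.filter_true_of_mem hr] at this
    omega
  have hge : M.card ≤ (M.biUnion (p3Nb H)).card + 1 := by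
    obtain ⟨r⟩ := hH.nonempty
    have h1 := p3_parent H hH M hME hM r
    have h2 : (M.filter (fun e => r ∈ e)).card ≤ 1 := by
      rw [Finset.card_le_one]
      intro a ha b hb
      simp only [Finset.mem_filter] at ha hb
      exact hM a ha.1 b hb.1 r ha.2 hb.2
    have h3 := Finset.card_filter_add_card_filter_not (s := M) (fun e => r ∈ e)
    omega
  set F := M.biUnion (p3Nb H) with hF
  have hmemF : ∀ e, e ∈ F ↔ e ∈ H.edgeSet ∧ e ∉ M := by
    intro e
    rw [hF, Finset.mem_biUnion]
    constructor
    · rintro ⟨m, hm, hme⟩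
      obtain ⟨a, b, v, c, d⟩ := (mem_p3Nb _ _ _).1 hme
      exact ⟨a, fun he => b (hM _ hm _ he v c d)⟩
    · rintro ⟨he, heM⟩
      induction e using Sym2.ind with
      | _ a b =>
        obtain ⟨m, hm, ham⟩ := hcov a
        exact ⟨m, hm, (mem_p3Nb _ _ _).2 ⟨he, fun h => heM (h ▸ hm), a, ham, by simp⟩⟩
  have hE' : ∀ e, e ∈ (H.deleteEdges ↑F).edgeSet ↔ e ∈ M := by
    intro e
    rw [SimpleGraph.edgeSet_deleteEdges, Set.mem_sdiff, Finset.mem_coe, hmemF]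
    have := hME e
    tauto
  have hadj' : ∀ a b, (H.deleteEdges ↑F).Adj a b ↔ s(a, b) ∈ M := fun a b => hE' s(a, b)
  have hE'f : (H.deleteEdges ↑F).edgeFinset = M := by
    ext e
    rw [SimpleGraph.mem_edgeFinset, hE']
  have huniq : ∀ v, ∃! w, (H.deleteEdges ↑F).Adj v w := by
    intro v
    obtain ⟨e, he, hv⟩ := hcov v
    obtain ⟨w, rfl⟩ := Sym2.mem_iff_exists.1 hv
    refine ⟨w, (hadj' _ _).2 he, fun y hy => ?_⟩
    have := hM _ he _ ((hadj' _ _).1 hy) v (by simp) (by simp)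
    exact (Sym2.congr_right.1 this).symm
  have hV : Fintype.card V = 2 * M.card := by
    have h1 := (H.deleteEdges ↑F).sum_degrees_eq_twice_card_edges
    rw [hE'f] at h1
    rw [← h1, Finset.sum_congr rfl
      (fun v _ => (SimpleGraph.degree_eq_one_iff_existsUnique_adj).2 (huniq v))]
    simp
  have hEc : H.edgeFinset.card = M.card + F.card := by
    rw [← Finset.card_union_of_disjoint]
    · congr 1
      ext e
      rw [SimpleGraph.mem_edgeFinset, Finset.mem_union, hmemF]
      have := hME e
      tauto
    · rw [Finset.disjoint_left]
      intro e he he'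
      exact ((hmemF e).1 he').2 he
  have htree : H.IsTree := by
    rw [SimpleGraph.isTree_iff_connected_and_card]
    refine ⟨hH, ?_⟩
    rw [Nat.card_eq_fintype_card, Nat.card_eq_fintype_card, ← SimpleGraph.edgeFinset_card]
    omega
  have hP : ∀ c : (H.deleteEdges ↑F).ConnectedComponent,
      (H.deleteEdges ↑F).IsP2Component c := by
    intro c
    induction c using SimpleGraph.ConnectedComponent.ind with
    | _ v =>
      obtain ⟨w, hw, hwu⟩ := huniq v
      refine ⟨v, w, hw, ?_⟩
      ext x
      rw [SimpleGraph.ConnectedComponent.mem_supp_iff, SimpleGraph.ConnectedComponent.eq]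
      constructor
      · rintro ⟨p⟩
        have main : ∀ a b : V, (H.deleteEdges ↑F).Walk a b → b ∈ ({v, w} : Set V) →
            a ∈ ({v, w} : Set V) := by
          intro a b p
          induction p with
          | nil => exact id
          | @cons a y b hay q ih =>
            intro hb
            rcases ih hb with rfl | h
            · right
              exact hwu _ hay.symm
            · left
              obtain rfl : y = w := h
              exact (huniq y).unique hay.symm hw.symm
        exact main x v p (by simp)
      · rintro (rfl | h)
        · exact SimpleGraph.Reachable.refl _
        · obtain rfl : x = w := h
          exact hw.symm.reachable
  refine hT M.card (by omega) ⟨htree, F, fun e he => ((hmemF e).1 he).1, by omega, hP, ?_⟩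
  rw [p3_card_comp _ hP, Nat.card_eq_fintype_card, ← SimpleGraph.edgeFinset_card, hE'f]

lemma p3_backward [Fintype V] (H : SimpleGraph V) (hH : H.Connected)
    (hT : ∀ k : ℕ, 1 ≤ k → ¬ H.InTk k) : H.HasFracP3Decomp := by
  have hall : ∀ S : Finset H.edgeSet,
      S.card ≤ (S.biUnion (fun e => p3Nb H e.1)).card := by
    intro S
    have h := p3_hall H (p3_matching H hH hT) (S.map (Function.Embedding.subtype _)) (by
      intro e he
      simp only [Finset.mem_map, Function.Embedding.subtype_apply] at he
      obtain ⟨x, -, rfl⟩ := he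
      exact x.2)
    rw [Finset.card_map] at h
    refine h.trans (Finset.card_le_card ?_)
    intro e he
    simp only [Finset.mem_biUnion, Finset.mem_map, Function.Embedding.subtype_apply] at he ⊢
    obtain ⟨_, ⟨x, hx, rfl⟩, h⟩ := he
    exact ⟨x, hx, h⟩
  obtain ⟨g, hginj, hg⟩ := (Finset.all_card_le_biUnion_card_iff_exists_injective _).1 hall
  have hg' := fun x => (mem_p3Nb _ _ _).1 (hg x)
  let σ : H.edgeSet → H.edgeSet := fun x => ⟨g x, (hg' x).1⟩
  have hσ : Function.Injective σ := fun x y h => hginj (congrArg Subtype.val h)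
  have hσs : Function.Surjective σ := Finite.surjective_of_injective hσ
  have hP3 : ∀ x : H.edgeSet, H.IsP3Sub s(x.1, g x) := fun x =>
    ⟨x.1, g x, rfl, x.2, (hg' x).1, (hg' x).2.1, (hg' x).2.2⟩
  refine ⟨fun K => (1 / 2 : ℝ) * ∑ x : H.edgeSet, if s(x.1, g x) = K then 1 else 0, ?_, ?_⟩
  · intro K
    beta_reduce
    rw [Finset.sum_boole]
    refine ⟨by positivity, ?_⟩
    have : (Finset.univ.filter (fun x : H.edgeSet => s(x.1, g x) = K)).card ≤ 2 := by
      induction K using Sym2.ind with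
      | _ a b =>
        refine (Finset.card_le_card_of_injOn (t := {a, b}) (fun x => x.1) ?_
          (Subtype.val_injective.injOn)).trans Finset.card_le_two
        intro x hx
        have hx := (Finset.mem_filter.1 hx).2
        have : x.1 ∈ s(a, b) := by rw [← hx]; simp
        simpa using this
    have : ((Finset.univ.filter (fun x : H.edgeSet => s(x.1, g x) = K)).card : ℝ) ≤ 2 := by
      exact_mod_cast this
    linarith
  · intro e he
    beta_reduce
    rw [← Finset.mul_sum, Finset.sum_comm]
    obtain ⟨y, hy⟩ := hσs ⟨e, he⟩
    have hgy : g y = e := congrArg Subtype.val hy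
    have hne : (⟨e, he⟩ : H.edgeSet) ≠ y := by
      rintro rfl
      exact (hg' ⟨e, he⟩).2.1 hgy.symm
    have h1 : ∀ x : H.edgeSet, (∑ K ∈ Finset.univ.filter
        (fun K : Sym2 (Sym2 V) => H.IsP3Sub K ∧ e ∈ K),
        if s(x.1, g x) = K then (1 : ℝ) else 0) =
        if x ∈ ({⟨e, he⟩, y} : Finset H.edgeSet) then 1 else 0 := by
      intro x
      rw [Finset.sum_ite_eq]
      congr 1
      simp only [Finset.mem_filter, Finset.mem_univ, true_and, hP3 x, Sym2.mem_iff,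
        Finset.mem_insert, Finset.mem_singleton, eq_iff_iff]
      constructor
      · rintro (h | h)
        · exact Or.inl (Subtype.ext h.symm)
        · exact Or.inr (hginj (h.symm.trans hgy.symm))
      · rintro (h | h)
        · exact Or.inl (by rw [h])
        · exact Or.inr (by rw [h, hgy])
    rw [Finset.sum_congr rfl (fun x _ => h1 x), Finset.sum_boole]
    rw [Finset.filter_mem_eq_inter, Finset.univ_inter, Finset.card_pair hne]
    norm_num

/-- A connected graph `H` has a fractional `P₃`-decomposition iff `H` does not belong to
`T_k` for any `k ≥ 1`. -/
theorem frac_p3_decomp_iff_not_inTk [Fintype V] (H : SimpleGraph V) (hH : H.Connected) :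
    H.HasFracP3Decomp ↔ ∀ k : ℕ, 1 ≤ k → ¬ H.InTk k := by
  exact ⟨fun hf k hk hT => p3_forward H hf k hk hT, p3_backward H hH⟩
end
end

section
/- For self-adjoint involutions A0, A1, B0, B1, C0, C1, D0, D1 on four commuting tensor factors, the operator inequality B_AB + B_BC + B_CD ≤ 2√10 · Id holds, where B_XY = X0Y0 + X0Y1 + X1Y0 − X1Y1. -/
set_option linter.unusedSimpArgs false

/-- Toner and Verstraete type bound `2 B_XY + B_YZ ≤ 2√10`. -/
theorem tv_bound {A : Type*} [Ring A] [StarRing A] [PartialOrder A]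
    [StarOrderedRing A] [Algebra ℝ A] [StarModule ℝ A]
    (a b p q c d : A)
    (ha : IsSelfAdjoint a) (hb : IsSelfAdjoint b)
    (hp : IsSelfAdjoint p) (hq : IsSelfAdjoint q)
    (hc : IsSelfAdjoint c) (hd : IsSelfAdjoint d)
    (ha2 : a * a = 1) (hb2 : b * b = 1) (hp2 : p * p = 1) (hq2 : q * q = 1)
    (hc2 : c * c = 1) (hd2 : d * d = 1)
    (pa : p * a = a * p) (pb : p * b = b * p) (qa : q * a = a * q) (qb : q * b = b * q)
    (ca : c * a = a * c) (cb : c * b = b * c) (da : d * a = a * d) (db : d * b = b * d)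
    (cp : c * p = p * c) (cq : c * q = q * c) (dp : d * p = p * d) (dq : d * q = q * d) :
    0 ≤ (2 * Real.sqrt 10 : ℝ) • (1 : A) -
      ((a * p + a * q + b * p - b * q) + (a * p + a * q + b * p - b * q)
        + (p * c + p * d + q * c - q * d)) := by
  have sq : ∀ {x y : A}, x * y = 1 → ∀ z, x * (y * z) = z := by
    intro x y h z; rw [← mul_assoc, h, one_mul]
  have lc : ∀ {x y : A}, x * y = y * x → ∀ z, x * (y * z) = y * (x * z) := by
    intro x y h z; rw [← mul_assoc, h, mul_assoc]
  have ha' : star a = a := ha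
  have hb' : star b = b := hb
  have hp' : star p = p := hp
  have hq' : star q = q := hq
  have hc' : star c = c := hc
  have hd' : star d = d := hd
  obtain ⟨M, hM⟩ : ∃ M, M = (a * p + a * q + b * p - b * q) + (a * p + a * q + b * p - b * q)
        + (p * c + p * d + q * c - q * d) := ⟨_, rfl⟩
  obtain ⟨E, hE⟩ : ∃ E, E = (4 : ℤ) • (a * c * (2 + (p * q + q * p)) + b * d * (2 - (p * q + q * p)))
      - ((4 : ℤ) • (a * b - b * a) + (c * d - d * c)) * (p * q - q * p) := ⟨_, rfl⟩
  have sM : star M = M := by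
    rw [hM]
    simp only [star_add, star_sub, star_mul, ha', hb', hp', hq', hc', hd',
      pa, pb, qa, qb, cp, cq, dp, dq]
  have h1 : M * M = 20 + E := by
    have n20 : (20 : A) = (20 : ℤ) • (1 : A) := by simp
    rw [n20, hM, hE, ← one_add_one_eq_two]
    simp only [mul_add, add_mul, mul_sub, sub_mul, mul_assoc, one_mul, mul_one, smul_add, smul_sub,
      mul_smul_comm, smul_mul_assoc,
      pa, pb, qa, qb, ca, cb, da, db, cp, cq, dp, dq,
      lc pa, lc pb, lc qa, lc qb, lc ca, lc cb, lc da, lc db, lc cp, lc cq, lc dp, lc dq,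
      ha2, hb2, hp2, hq2, hc2, hd2, sq ha2, sq hb2, sq hp2, sq hq2, sq hc2, sq hd2]
    noncomm_ring
  have sE : star E = E := by
    have : E = M * M - 20 := by rw [h1]; abel
    rw [this, star_sub, star_mul, sM, star_ofNat]
  obtain ⟨F, hF⟩ : ∃ F, F = p * q + q * p := ⟨_, rfl⟩
  obtain ⟨G, hG⟩ : ∃ G, G = (p * q - q * p) * ((4 : ℤ) • (a * b + b * a) - (c * d + d * c)) :=
    ⟨_, rfl⟩
  have h2 : 400 - E * E = (36 : ℤ) • (star F * F) + star G * G := by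
    have n400 : (400 : A) = (400 : ℤ) • (1 : A) := by simp
    rw [n400, hE, hF, hG, ← one_add_one_eq_two]
    simp only [star_add, star_sub, star_mul, star_zsmul, ha', hb', hp', hq', hc', hd']
    simp only [mul_add, add_mul, mul_sub, sub_mul, mul_assoc, one_mul, mul_one, smul_add, smul_sub,
      mul_smul_comm, smul_mul_assoc,
      pa, pb, qa, qb, ca, cb, da, db, cp, cq, dp, dq,
      lc pa, lc pb, lc qa, lc qb, lc ca, lc cb, lc da, lc db, lc cp, lc cq, lc dp, lc dq,
      ha2, hb2, hp2, hq2, hc2, hd2, sq ha2, sq hb2, sq hp2, sq hq2, sq hc2, sq hd2]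
    noncomm_ring
  have sm : ∀ (r : ℝ) (x : A), 0 ≤ r → 0 ≤ r • (star x * x) := by
    intro r x hr
    have : r • (star x * x) = star (Real.sqrt r • x) * (Real.sqrt r • x) := by
      rw [star_smul, smul_mul_smul_comm, star_trivial (Real.sqrt r), Real.mul_self_sqrt hr]
    rw [this]; exact star_mul_self_nonneg _
  rw [← hM]
  obtain ⟨k, hk⟩ : ∃ k, k = 2 * Real.sqrt 10 := ⟨_, rfl⟩
  have k0 : 0 < k := by rw [hk]; positivity
  have kk : k * k = 40 := by
    rw [hk]; nlinarith [Real.mul_self_sqrt (show (0 : ℝ) ≤ 10 by norm_num)]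
  rw [← hk]
  have e1 : (20 : A) = (20 : ℝ) • (1 : A) := by
    rw [← Algebra.algebraMap_eq_smul_one, map_ofNat]
  have e2 : (400 : A) = (400 : ℝ) • (1 : A) := by
    rw [← Algebra.algebraMap_eq_smul_one, map_ofNat]
  have h2' : E * E = (400 : ℝ) • (1 : A) - (36 : ℝ) • (star F * F) - star G * G := by
    have : (36 : ℝ) • (star F * F) = (36 : ℤ) • (star F * F) := by
      rw [← Int.cast_smul_eq_zsmul ℝ]; norm_num
    rw [this, ← e2, sub_sub, ← h2]; abel
  have key : k • (1 : A) - M =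
      (1 / (2 * k)) • (star (k • (1 : A) - M) * (k • (1 : A) - M))
      + (1 / (80 * k)) • (star ((20 : ℝ) • (1 : A) - E) * ((20 : ℝ) • (1 : A) - E))
      + (36 / (80 * k)) • (star F * F) + (1 / (80 * k)) • (star G * G) := by
    have x1 : star (k • (1 : A) - M) * (k • (1 : A) - M) =
        (60 : ℝ) • (1 : A) + E - (2 * k) • M := by
      simp only [star_sub, star_smul, star_trivial, star_one, sM, sub_mul, mul_sub,
        smul_mul_assoc, mul_smul_comm, one_mul, mul_one, smul_smul, kk, h1, e1]
      match_scalars <;> linarith [kk]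
    have x2 : star ((20 : ℝ) • (1 : A) - E) * ((20 : ℝ) • (1 : A) - E) =
        (800 : ℝ) • (1 : A) - (40 : ℝ) • E - (36 : ℝ) • (star F * F) - star G * G := by
      simp only [star_sub, star_smul, star_trivial, star_one, sE, sub_mul, mul_sub,
        smul_mul_assoc, mul_smul_comm, one_mul, mul_one, smul_smul, h2']
      module
    rw [x1, x2]
    have hk' : k = 40 / k := by field_simp; nlinarith
    have : k • (1 : A) = (40 / k) • (1 : A) := by rw [← hk']
    rw [this]
    match_scalars <;> field_simp <;> ring
  rw [key]
  refine add_nonneg (add_nonneg (add_nonneg ?_ ?_) ?_) ?_ <;> exact sm _ _ (by positivity)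

/-- Monogamy on `P₄`: for `±1`-observables of four parties `A`, `B`, `C`, `D`
(self-adjoint involutions, operators of distinct parties commuting), the Bell operator
inequality `B_AB + B_BC + B_CD ≤ 2√10 · 1` holds. -/
theorem chsh_p4_monogamy {A : Type*} [Ring A] [StarRing A] [PartialOrder A]
    [StarOrderedRing A] [Algebra ℝ A] [StarModule ℝ A]
    (A₀ A₁ B₀ B₁ C₀ C₁ D₀ D₁ : A)
    (hA₀ : IsSelfAdjoint A₀) (hA₁ : IsSelfAdjoint A₁)
    (hB₀ : IsSelfAdjoint B₀) (hB₁ : IsSelfAdjoint B₁)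
    (hC₀ : IsSelfAdjoint C₀) (hC₁ : IsSelfAdjoint C₁)
    (hD₀ : IsSelfAdjoint D₀) (hD₁ : IsSelfAdjoint D₁)
    (hA₀2 : A₀ ^ 2 = 1) (hA₁2 : A₁ ^ 2 = 1) (hB₀2 : B₀ ^ 2 = 1) (hB₁2 : B₁ ^ 2 = 1)
    (hC₀2 : C₀ ^ 2 = 1) (hC₁2 : C₁ ^ 2 = 1) (hD₀2 : D₀ ^ 2 = 1) (hD₁2 : D₁ ^ 2 = 1)
    (hcomm : ∀ X ∈ ({A₀, A₁} : Set A), ∀ Y ∈ ({B₀, B₁, C₀, C₁, D₀, D₁} : Set A),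
      Commute X Y)
    (hcomm' : ∀ X ∈ ({B₀, B₁} : Set A), ∀ Y ∈ ({C₀, C₁, D₀, D₁} : Set A), Commute X Y)
    (hcomm'' : ∀ X ∈ ({C₀, C₁} : Set A), ∀ Y ∈ ({D₀, D₁} : Set A), Commute X Y) :
    (A₀ * B₀ + A₀ * B₁ + A₁ * B₀ - A₁ * B₁) +
        (B₀ * C₀ + B₀ * C₁ + B₁ * C₀ - B₁ * C₁) +
        (C₀ * D₀ + C₀ * D₁ + C₁ * D₀ - C₁ * D₁) ≤
      (2 * Real.sqrt 10 : ℝ) • (1 : A) := by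
  simp only [Set.mem_insert_iff, Set.mem_singleton_iff, forall_eq_or_imp, forall_eq] at hcomm hcomm' hcomm''
  obtain ⟨⟨ab, ab', ac, ac', ad, ad'⟩, eb, eb', ec, ec', ed, ed'⟩ := hcomm
  obtain ⟨⟨bc, bc', bd, bd'⟩, fc, fc', fd, fd'⟩ := hcomm'
  obtain ⟨⟨cd, cd'⟩, gd, gd'⟩ := hcomm''
  rw [pow_two] at hA₀2 hA₁2 hB₀2 hB₁2 hC₀2 hC₁2 hD₀2 hD₁2
  have h1 := tv_bound A₀ A₁ B₀ B₁ C₀ C₁ hA₀ hA₁ hB₀ hB₁ hC₀ hC₁ hA₀2 hA₁2 hB₀2 hB₁2 hC₀2 hC₁2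
    ab.eq.symm eb.eq.symm ab'.eq.symm eb'.eq.symm ac.eq.symm ec.eq.symm ac'.eq.symm ec'.eq.symm
    bc.eq.symm fc.eq.symm bc'.eq.symm fc'.eq.symm
  have h2 := tv_bound D₀ D₁ C₀ C₁ B₀ B₁ hD₀ hD₁ hC₀ hC₁ hB₀ hB₁ hD₀2 hD₁2 hC₀2 hC₁2 hB₀2 hB₁2
    cd.eq cd'.eq gd.eq gd'.eq bd.eq bd'.eq fd.eq fd'.eq
    bc.eq bc'.eq fc.eq fc'.eq
  rw [← cd.eq, ← cd'.eq, ← gd.eq, ← gd'.eq, ← bc.eq, ← bc'.eq, ← fc.eq, ← fc'.eq] at h2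
  have h3 := add_nonneg h1 h2
  have sm : ∀ (x : A), 0 ≤ x + x → 0 ≤ x := by
    intro x hx
    have h := star_left_conjugate_nonneg hx ((Real.sqrt (1 / 2)) • (1 : A))
    have e : star ((Real.sqrt (1 / 2)) • (1 : A)) * (x + x) * ((Real.sqrt (1 / 2)) • (1 : A)) = x := by
      rw [star_smul, star_one, star_trivial (Real.sqrt _), smul_mul_assoc, one_mul, mul_smul_comm, mul_one,
        smul_smul, Real.mul_self_sqrt (by norm_num)]
      module
    rwa [e] at h
  rw [← sub_nonneg]
  apply sm
  convert h3 using 1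
  abel
end
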